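/- arXiv:2409.18573 — 14 statements merged into one kernel-verified Lean document; each statement's English description precedes it below -/
import Mathlib

section
/- Let m ≥ 1, let n̄_1, …, n̄_m be integers with n̄_i ≥ 2 for all i, let ε > 0, and define ε*_i := ε · (n̄_i − 1)^{1/3} / ∑_{j=1}^{m} (n̄_j − 1)^{1/3} for i = 1, …, m. Then ∑_{i=1}^{m} ε*_i = ε, and for every tuple of positive reals ε'_1, …, ε'_m with ∑_{i=1}^{m} ε'_i = ε, one has ∑_{i=1}^{m} (n̄_i − 1)/(ε'_i)² ≥ ∑_{i=1}^{m} (n̄_i − 1)/(ε*_i)² = (∑_{i=1}^{m} (n̄_i − 1)^{1/3})³ / ε². -/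
/-- Optimal privacy-budget allocation for fixed integer branching factors
`n̄_1, …, n̄_m ≥ 2`: setting `ε*_i = ε·(n̄_i−1)^{1/3}/∑_j (n̄_j−1)^{1/3}`, the
budgets sum to `ε`, they minimize `∑_i (n̄_i−1)/ε_i²` among all positive
budgets summing to `ε`, and the optimal value is
`(∑_i (n̄_i−1)^{1/3})³ / ε²`. -/
theorem optimal_privacy_budgets (m : ℕ) (hm : 1 ≤ m)
    (n : Fin m → ℤ) (hn : ∀ i, 2 ≤ n i) (ε : ℝ) (hε : 0 < ε)
    (εs : Fin m → ℝ)
    (hεs : ∀ i, εs i =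
      ε * ((n i : ℝ) - 1) ^ ((1 : ℝ) / 3)
        / ∑ j, ((n j : ℝ) - 1) ^ ((1 : ℝ) / 3)) :
    (∑ i, εs i = ε) ∧
    (∀ ε' : Fin m → ℝ, (∀ i, 0 < ε' i) → (∑ i, ε' i = ε) →
      ∑ i, ((n i : ℝ) - 1) / (ε' i) ^ 2 ≥ ∑ i, ((n i : ℝ) - 1) / (εs i) ^ 2) ∧
    (∑ i, ((n i : ℝ) - 1) / (εs i) ^ 2
      = (∑ i, ((n i : ℝ) - 1) ^ ((1 : ℝ) / 3)) ^ 3 / ε ^ 2) := by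
  have hc : ∃ c : Fin m → ℝ, ∀ i, c i = ((n i : ℝ) - 1) ^ ((1 : ℝ) / 3) := ⟨_, fun _ => rfl⟩
  obtain ⟨c, hc⟩ := hc
  have hpos : ∀ i, (0 : ℝ) < (n i : ℝ) - 1 := by
    intro i
    have : (2 : ℝ) ≤ (n i : ℝ) := by exact_mod_cast hn i
    linarith
  have hc0 : ∀ i, 0 < c i := fun i => by
    rw [hc]; exact Real.rpow_pos_of_pos (hpos i) _
  have hc3 : ∀ i, (n i : ℝ) - 1 = c i ^ 3 := fun i => by
    rw [hc, ← Real.rpow_natCast, ← Real.rpow_mul (hpos i).le]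
    norm_num
  simp only [← hc] at hεs ⊢
  simp only [hc3]
  have hS : 0 < ∑ j, c j :=
    Finset.sum_pos (fun i _ => hc0 i) ⟨⟨0, hm⟩, Finset.mem_univ _⟩
  have hsum : ∑ i, c i = ∑ j, c j := rfl
  generalize hSd : ∑ j, c j = S at *
  have h3 : ∑ i, c i ^ 3 / (εs i) ^ 2 = S ^ 3 / ε ^ 2 := by
    have : ∀ i, c i ^ 3 / (εs i) ^ 2 = c i * (S ^ 2 / ε ^ 2) := fun i => by
      have := hc0 i
      rw [hεs]; field_simp
    simp only [this]
    rw [← Finset.sum_mul, hSd]; ring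
  refine ⟨?_, ?_, h3⟩
  · simp only [hεs]
    rw [← Finset.sum_div, ← Finset.mul_sum, hSd]
    field_simp
  · intro x hx hxs
    rw [h3]
    have ht : 0 < S / ε := by positivity
    have key : ∀ i, 3 * (S / ε) ^ 2 * c i - 2 * (S / ε) ^ 3 * x i ≤ c i ^ 3 / (x i) ^ 2 := fun i => by
      have h1 := hc0 i
      have h2 := hx i
      generalize S / ε = t at *
      obtain ⟨y, hy⟩ : ∃ y, y = c i / x i := ⟨_, rfl⟩
      have hy0 : 0 < y := by rw [hy]; positivity
      have e : c i = y * x i := by rw [hy]; field_simp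
      have e2 : c i ^ 3 / (x i) ^ 2 = y ^ 3 * x i := by rw [e]; field_simp
      rw [e2, e]
      have : 0 ≤ (y - t) ^ 2 * (y + 2 * t) * x i := by positivity
      nlinarith
    have := Finset.sum_le_sum (s := Finset.univ) (fun i _ => key i)
    rw [Finset.sum_sub_distrib, ← Finset.mul_sum, ← Finset.mul_sum, hSd, hxs] at this
    refine le_trans (le_of_eq ?_) this
    field_simp
    ring
end

section
/- Let m ≥ 1, let ε̄_1, …, ε̄_m be positive real numbers, let K > 0 be a real number, and define n*_i := K^{1/m} · ε̄_i² / (∏_{j=1}^{m} ε̄_j²)^{1/m} for i = 1, …, m. Then ∏_{i=1}^{m} n*_i = K, and for every tuple of positive reals n_1, …, n_m with ∏_{i=1}^{m} n_i = K, one has ∑_{i=1}^{m} (n_i − 1)/ε̄_i² ≥ ∑_{i=1}^{m} (n*_i − 1)/ε̄_i². -/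
/-- Optimal (real-relaxed) branching factors for fixed positive privacy
budgets `ε̄_1, …, ε̄_m`: setting `n*_i = K^{1/m}·ε̄_i²/(∏_j ε̄_j²)^{1/m}`, the
factors multiply to `K`, and they minimize `∑_i (n_i−1)/ε̄_i²` among all
positive tuples multiplying to `K`. -/
theorem optimal_branching_factors (m : ℕ) (hm : 1 ≤ m)
    (εb : Fin m → ℝ) (hεb : ∀ i, 0 < εb i) (K : ℝ) (hK : 0 < K)
    (ns : Fin m → ℝ)
    (hns : ∀ i, ns i =
      K ^ ((1 : ℝ) / m) * (εb i) ^ 2 / (∏ j, (εb j) ^ 2) ^ ((1 : ℝ) / m)) :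
    (∏ i, ns i = K) ∧
    (∀ n : Fin m → ℝ, (∀ i, 0 < n i) → (∏ i, n i = K) →
      ∑ i, (n i - 1) / (εb i) ^ 2 ≥ ∑ i, (ns i - 1) / (εb i) ^ 2) := by
  have hm0 : (m : ℝ) ≠ 0 := by
    have : m ≠ 0 := by omega
    exact_mod_cast this
  have hm0' : m ≠ 0 := by omega
  have hP : 0 < ∏ j, (εb j) ^ 2 := Finset.prod_pos fun i _ => pow_pos (hεb i) 2
  set P := ∏ j, (εb j) ^ 2 with hPdef
  have hroot : ∀ x : ℝ, 0 < x → (x ^ ((1 : ℝ) / m)) ^ m = x := by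
    intro x hx
    rw [one_div]
    exact Real.rpow_inv_natCast_pow hx.le hm0'
  refine ⟨?_, ?_⟩
  · simp only [hns]
    rw [Finset.prod_div_distrib, Finset.prod_mul_distrib, Finset.prod_const, Finset.prod_const,
      Finset.card_univ, Fintype.card_fin, hroot K hK, hroot P hP, ← hPdef]
    field_simp
  · intro n hn hprod
    have key := Real.geom_mean_le_arith_mean_weighted Finset.univ
      (fun _ : Fin m => (1 : ℝ) / m) (fun i => n i / (εb i) ^ 2)
      (fun i _ => by positivity)
      (by simp [hm0])
      (fun i _ => (div_pos (hn i) (pow_pos (hεb i) 2)).le)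
    rw [Real.finsetProd_rpow _ _ (fun i _ => (div_pos (hn i) (pow_pos (hεb i) 2)).le),
      Finset.prod_div_distrib, hprod, ← hPdef, ← Finset.mul_sum,
      Real.div_rpow hK.le hP.le] at key
    have hs : ∑ i, ns i / (εb i) ^ 2 = m * (K ^ ((1 : ℝ) / m) / P ^ ((1 : ℝ) / m)) := by
      have : ∀ i, ns i / (εb i) ^ 2 = K ^ ((1 : ℝ) / m) / P ^ ((1 : ℝ) / m) := by
        intro i
        have h1 := (hεb i).ne'
        rw [hns i, div_right_comm, mul_div_assoc, div_self (pow_ne_zero 2 h1), mul_one]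
      simp [this]
    simp only [sub_div, Finset.sum_sub_distrib]
    have h2 : (m : ℝ) * (K ^ ((1 : ℝ) / m) / P ^ ((1 : ℝ) / m)) ≤ ∑ i, n i / (εb i) ^ 2 := by
      have h3 := mul_le_mul_of_nonneg_left key (Nat.cast_nonneg (α := ℝ) m)
      rwa [← mul_assoc (m : ℝ) (1 / m), mul_one_div_cancel hm0, one_mul] at h3
    linarith
end

section
/- Let m ≥ 1, let K > 0 and ε > 0 be real numbers. For all tuples of positive reals n_1, …, n_m and ε_1, …, ε_m with ∏_{i=1}^{m} n_i = K and ∑_{i=1}^{m} ε_i = ε, one has ∑_{i=1}^{m} n_i/ε_i² ≥ m³ · K^{1/m} / ε², with equality if and only if n_i = K^{1/m} and ε_i = ε/m for all i. -/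
lemma term_bound_aux (a b : ℝ) (ha : 0 < a) (hb : 0 < b) :
    1 + Real.log a - 2 * (b - 1) ≤ a / b ^ 2 ∧
    (1 + Real.log a - 2 * (b - 1) = a / b ^ 2 → a = 1 ∧ b = 1) := by
  have hpos : 0 < a / b ^ 2 := by positivity
  have hl : Real.log (a / b ^ 2) = Real.log a - 2 * Real.log b := by
    rw [Real.log_div ha.ne' (by positivity), Real.log_pow]; norm_num
  have h1 := Real.log_le_sub_one_of_pos hpos
  have h2 := Real.log_le_sub_one_of_pos hb
  refine ⟨by linarith, fun h => ?_⟩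
  have hb1 : b = 1 := by
    by_contra hne
    have := Real.log_lt_sub_one_of_pos hb hne
    linarith
  refine ⟨?_, hb1⟩
  by_contra hne
  have := Real.log_lt_sub_one_of_pos ha hne
  subst hb1
  norm_num at h
  linarith

/-- Joint minimization of the error upper bound `∑_i n_i/ε_i²` over
branching factors with `∏ n_i = K` and budgets with `∑ ε_i = ε`:
the minimum is `m³·K^{1/m}/ε²`, attained exactly at the uniform choice
`n_i = K^{1/m}`, `ε_i = ε/m`. -/
theorem joint_min_error_upper_bound (m : ℕ) (hm : 1 ≤ m)
    (K ε : ℝ) (hK : 0 < K) (hε : 0 < ε)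
    (n εv : Fin m → ℝ) (hn : ∀ i, 0 < n i) (hεv : ∀ i, 0 < εv i)
    (hprod : ∏ i, n i = K) (hsum : ∑ i, εv i = ε) :
    ∑ i, n i / (εv i) ^ 2 ≥ (m : ℝ) ^ 3 * K ^ ((1 : ℝ) / m) / ε ^ 2 ∧
    (∑ i, n i / (εv i) ^ 2 = (m : ℝ) ^ 3 * K ^ ((1 : ℝ) / m) / ε ^ 2 ↔
      ∀ i, n i = K ^ ((1 : ℝ) / m) ∧ εv i = ε / m) := by
  have hm0 : (0 : ℝ) < m := by exact_mod_cast hm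
  obtain ⟨G, hG⟩ : ∃ G, G = K ^ ((1 : ℝ) / m) := ⟨_, rfl⟩
  rw [← hG]
  have hGpos : 0 < G := hG ▸ Real.rpow_pos_of_pos hK _
  have hlogG : (m : ℝ) * Real.log G = Real.log K := by
    rw [hG, Real.log_rpow hK]; field_simp
  have he : 0 < ε / m := by positivity
  have hc : 0 < G / (ε / m) ^ 2 := by positivity
  have hT : ∀ i, _ := fun i =>
    term_bound_aux (n i / G) (εv i / (ε / m)) (div_pos (hn i) hGpos) (div_pos (hεv i) he)
  have hS : ∑ i, n i / (εv i) ^ 2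
      = G / (ε / m) ^ 2 * ∑ i, (n i / G) / (εv i / (ε / m)) ^ 2 := by
    rw [Finset.mul_sum]
    refine Finset.sum_congr rfl fun i _ => ?_
    have := (hεv i).ne'
    field_simp
  have hR : (m : ℝ) ^ 3 * G / ε ^ 2 = G / (ε / m) ^ 2 * m := by
    field_simp
  have hL : ∑ i, (1 + Real.log (n i / G) - 2 * (εv i / (ε / m) - 1)) = m := by
    have h1 : ∑ i, Real.log (n i / G) = 0 := by
      simp_rw [fun i => Real.log_div (hn i).ne' hGpos.ne']
      rw [Finset.sum_sub_distrib, ← Real.log_prod (fun i _ => (hn i).ne'), hprod]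
      simp [hlogG]
    have h2 : ∑ i, εv i / (ε / m) = m := by
      rw [← Finset.sum_div, hsum]; field_simp
    rw [Finset.sum_sub_distrib, Finset.sum_add_distrib, ← Finset.mul_sum,
      Finset.sum_sub_distrib, h1, h2]
    simp
  rw [hS, hR]
  have hle := Finset.sum_le_sum (s := Finset.univ) fun i _ => (hT i).1
  rw [hL] at hle
  refine ⟨mul_le_mul_of_nonneg_left hle hc.le, fun h => ?_, fun h => ?_⟩
  · have h' := mul_left_cancel₀ hc.ne' h
    have h3 := (Finset.sum_eq_sum_iff_of_le fun i _ => (hT i).1).1 (hL.trans h'.symm)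
    intro i
    obtain ⟨h4, h5⟩ := (hT i).2 (h3 i (Finset.mem_univ i))
    exact ⟨(div_eq_one_iff_eq hGpos.ne').1 h4, (div_eq_one_iff_eq he.ne').1 h5⟩
  · congr 1
    simp_rw [fun i => (h i).1, fun i => (h i).2, div_self hGpos.ne', div_self he.ne']
    simp
end

section
/- Let m ≥ 1, let K > 0 and ε > 0 be real numbers with K^{1/m} ≥ 3. For all tuples of reals n_1, …, n_m with n_i ≥ 3 for all i and ∏_{i=1}^{m} n_i = K, and all positive reals ε_1, …, ε_m with ∑_{i=1}^{m} ε_i = ε, one has ∑_{i=1}^{m} (n_i − 1)/ε_i² ≥ m³ · (K^{1/m} − 1) / ε², with equality when n_i = K^{1/m} and ε_i = ε/m for all i. -/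
lemma aux_key (c s : ℝ) (hc : 2 ≤ c) (hs : 0 < s) (h : 2 ≤ c * s ^ 3) :
    (c + 1) * (Real.log (1 + c * s ^ 3) - Real.log (1 + c)) ≤ 3 * c * (s - 1) := by
  let g : ℝ → ℝ := fun x => 3 * c * x - (c + 1) * Real.log (1 + c * x ^ 3)
  have hd : ∀ x, 0 < x → HasDerivAt g
      (3 * c * ((x - 1) * (c * x ^ 2 - x - 1)) / (1 + c * x ^ 3)) x := by
    intro x hx
    have hp : (1 + c * x ^ 3) ≠ 0 := by positivity
    have h1 : HasDerivAt (fun x : ℝ => 1 + c * x ^ 3) (c * (3 * x ^ 2)) x := by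
      have := ((hasDerivAt_pow 3 x).const_mul c).const_add 1
      simpa using this
    have h2 := ((hasDerivAt_id x).const_mul (3 * c)).sub ((h1.log hp).const_mul (c + 1))
    refine h2.congr_deriv ?_
    field_simp
    ring
  have key : g 1 ≤ g s := by
    rcases le_total 1 s with h1 | h1
    · have hm : MonotoneOn g (Set.Icc 1 s) := by
        apply monotoneOn_of_deriv_nonneg (convex_Icc 1 s)
        · intro x hx
          exact (hd x (by linarith [hx.1])).continuousAt.continuousWithinAt
        · intro x hx
          rw [interior_Icc] at hx
          exact (hd x (by linarith [hx.1])).differentiableAt.differentiableWithinAt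
        · intro x hx
          rw [interior_Icc] at hx
          have hx1 := hx.1
          rw [(hd x (by linarith)).deriv]
          have a : 0 ≤ x - 1 := by linarith
          have b : 0 ≤ c * x ^ 2 - x - 1 := by nlinarith [sq_nonneg x]
          have : 0 < x := by linarith
          positivity
      exact hm ⟨le_rfl, h1⟩ ⟨h1, le_rfl⟩ h1
    · have hm : AntitoneOn g (Set.Icc s 1) := by
        apply antitoneOn_of_deriv_nonpos (convex_Icc s 1)
        · intro x hx
          exact (hd x (by linarith [hx.1])).continuousAt.continuousWithinAt
        · intro x hx
          rw [interior_Icc] at hx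
          exact (hd x (by linarith [hx.1])).differentiableAt.differentiableWithinAt
        · intro x hx
          rw [interior_Icc] at hx
          obtain ⟨hx1, hx2⟩ := hx
          have hx0 : 0 < x := by linarith
          rw [(hd x hx0).deriv]
          have a : 0 ≤ 1 - x := by linarith
          have h3 : 2 ≤ c * x ^ 3 := by
            have : s ^ 3 ≤ x ^ 3 := by gcongr
            nlinarith
          have b : 0 ≤ c * x ^ 2 - x - 1 := by
            have : c * x ^ 3 ≤ c * x ^ 2 := by
              have : x ^ 3 ≤ x ^ 2 := by nlinarith [sq_nonneg x]
              nlinarith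
            linarith
          have e : 3 * c * ((x - 1) * (c * x ^ 2 - x - 1)) / (1 + c * x ^ 3)
            = -(3 * c * ((1 - x) * (c * x ^ 2 - x - 1)) / (1 + c * x ^ 3)) := by ring
          rw [e, neg_nonpos]
          positivity
      exact hm ⟨le_rfl, h1⟩ ⟨h1, le_rfl⟩ h1
  simp only [g] at key
  norm_num at key
  linarith

lemma aux_term (q n t : ℝ) (hq : 3 ≤ q) (hn : 3 ≤ n) (ht : 0 < t) :
    (q - 1) + q * (Real.log n - Real.log q) - 2 * (q - 1) * (t - 1) ≤ (n - 1) / t ^ 2 := by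
  have hc : 0 < q - 1 := by linarith
  have hd : 0 < (n - 1) / (q - 1) := div_pos (by linarith) hc
  obtain ⟨s, hs, hs3⟩ : ∃ s : ℝ, 0 < s ∧ s ^ 3 = (n - 1) / (q - 1) := by
    refine ⟨((n - 1) / (q - 1)) ^ ((1 : ℝ) / 3), Real.rpow_pos_of_pos hd _, ?_⟩
    rw [← Real.rpow_natCast, ← Real.rpow_mul hd.le]
    norm_num
  have hn' : (q - 1) * s ^ 3 = n - 1 := by rw [hs3]; field_simp
  have h := aux_key (q - 1) s (by linarith) hs (by linarith)
  rw [hn', show 1 + (n - 1) = n by ring, show 1 + (q - 1) = q by ring,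
    show q - 1 + 1 = q by ring] at h
  have h2 : 3 * s - 2 * t ≤ s ^ 3 / t ^ 2 := by
    rw [le_div_iff₀ (by positivity)]
    nlinarith [mul_nonneg (by positivity : 0 ≤ s + 2 * t) (sq_nonneg (s - t))]
  have h3 := mul_le_mul_of_nonneg_left h2 hc.le
  rw [← hn', mul_div_assoc]
  linarith


/-- Joint minimization of the exact error `∑_i (n_i−1)/ε_i²` over branching
factors `n_i ≥ 3` with `∏ n_i = K` and positive budgets with `∑ ε_i = ε`:
the value `m³·(K^{1/m} − 1)/ε²` is a lower bound, attained by the uniform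
choice `n_i = K^{1/m}`, `ε_i = ε/m`. -/
theorem joint_min_exact_error (m : ℕ) (hm : 1 ≤ m)
    (K ε : ℝ) (hK : 0 < K) (hε : 0 < ε)
    (hK3 : 3 ≤ K ^ ((1 : ℝ) / m)) :
    (∀ n εv : Fin m → ℝ, (∀ i, 3 ≤ n i) → (∏ i, n i = K) →
        (∀ i, 0 < εv i) → (∑ i, εv i = ε) →
      ∑ i, (n i - 1) / (εv i) ^ 2
        ≥ (m : ℝ) ^ 3 * (K ^ ((1 : ℝ) / m) - 1) / ε ^ 2) ∧
    (∑ _i : Fin m, (K ^ ((1 : ℝ) / m) - 1) / (ε / m) ^ 2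
      = (m : ℝ) ^ 3 * (K ^ ((1 : ℝ) / m) - 1) / ε ^ 2) := by
  have hm0 : (0 : ℝ) < m := by exact_mod_cast hm
  refine ⟨?_, ?_⟩
  · intro n εv hn hprod hpos hsum
    set q := K ^ ((1 : ℝ) / m) with hq
    have hlog : Real.log K = m * Real.log q := by
      rw [hq, Real.log_rpow hK]
      field_simp
    have hlog2 : ∑ i, Real.log (n i) = m * Real.log q := by
      rw [← hlog, ← hprod, Real.log_prod]
      intro i _
      linarith [hn i]
    have hterm := Finset.sum_le_sum (s := Finset.univ) fun i _ =>
      aux_term q (n i) (m / ε * εv i) hK3 (hn i) (mul_pos (by positivity) (hpos i))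
    have hL : ∑ i, ((q - 1) + q * (Real.log (n i) - Real.log q)
        - 2 * (q - 1) * (m / ε * εv i - 1)) = m * (q - 1) := by
      simp only [Finset.sum_add_distrib, Finset.sum_sub_distrib, ← Finset.mul_sum, hlog2, hsum]
      simp
      field_simp
      ring
    have hR : ∑ i, (n i - 1) / (m / ε * εv i) ^ 2
        = (ε ^ 2 / m ^ 2) * ∑ i, (n i - 1) / (εv i) ^ 2 := by
      rw [Finset.mul_sum]
      refine Finset.sum_congr rfl fun i _ => ?_
      have := (hpos i).ne'
      field_simp
    rw [hL, hR] at hterm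
    rw [ge_iff_le, div_le_iff₀ (by positivity)]
    have h := mul_le_mul_of_nonneg_left hterm (sq_nonneg (m : ℝ))
    have e : (m : ℝ) ^ 2 * ((ε ^ 2 / m ^ 2) * ∑ i, (n i - 1) / (εv i) ^ 2)
      = (∑ i, (n i - 1) / (εv i) ^ 2) * ε ^ 2 := by field_simp
    rw [e] at h
    linarith
  · simp only [Finset.sum_const, Finset.card_univ, Fintype.card_fin, nsmul_eq_mul]
    field_simp
end

section
/- The function φ : ℝ × ℝ → ℝ given by φ(r, ε) = (e^r − 1)/ε² is convex on the set {(r, ε) : r ≥ log 3, ε > 0}, where log denotes the natural logarithm. -/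
theorem phi_line (a b c d : ℝ) (h : ∀ t ∈ Set.Icc (0:ℝ) 1, Real.log 3 ≤ a + b * t ∧ 0 < c + d * t) :
    ConvexOn ℝ (Set.Icc (0:ℝ) 1) (fun t => (Real.exp (a + b * t) - 1) / (c + d * t) ^ 2) := by
  have hl : ∀ (x y t : ℝ), HasDerivAt (fun t => x + y * t) y t := by
    intro x y t
    simpa using ((hasDerivAt_id t).const_mul y).const_add x
  have h1 : ∀ t ∈ Set.Icc (0:ℝ) 1, HasDerivAt
      (fun t => (Real.exp (a + b * t) - 1) / (c + d * t) ^ 2)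
      (b * Real.exp (a + b * t) / (c + d * t) ^ 2
        - 2 * d * (Real.exp (a + b * t) - 1) / (c + d * t) ^ 3) t := by
    intro t ht
    have hp := (h t ht).2
    have := (((hl a b t).exp).sub_const 1).fun_div ((hl c d t).fun_pow 2) (by positivity)
    refine this.congr_deriv ?_
    have hn := hp.ne'
    clear this
    generalize Real.exp (a + b * t) = E at *
    generalize c + d * t = s at *
    norm_num
    field_simp
  have h2 : ∀ t ∈ Set.Icc (0:ℝ) 1, HasDerivAt
      (fun t => b * Real.exp (a + b * t) / (c + d * t) ^ 2
        - 2 * d * (Real.exp (a + b * t) - 1) / (c + d * t) ^ 3)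
      ((b ^ 2 * Real.exp (a + b * t) * (c + d * t) ^ 2
        - 4 * b * d * Real.exp (a + b * t) * (c + d * t)
        + 6 * d ^ 2 * (Real.exp (a + b * t) - 1)) / (c + d * t) ^ 4) t := by
    intro t ht
    have hp := (h t ht).2
    have := ((((hl a b t).exp).const_mul b).fun_div ((hl c d t).fun_pow 2) (by positivity)).fun_sub
      (((((hl a b t).exp).sub_const 1).const_mul (2 * d)).fun_div ((hl c d t).fun_pow 3) (by positivity))
    refine this.congr_deriv ?_
    have hn := hp.ne'
    clear this
    generalize Real.exp (a + b * t) = E at *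
    generalize c + d * t = s at *
    norm_num
    field_simp
    ring
  refine convexOn_of_hasDerivWithinAt2_nonneg (convex_Icc 0 1)
    (fun t ht => (h1 t ht).continuousAt.continuousWithinAt)
    (fun t ht => (h1 t (interior_subset ht)).hasDerivWithinAt)
    (fun t ht => (h2 t (interior_subset ht)).hasDerivWithinAt) ?_
  intro t ht
  obtain ⟨hr, hp⟩ := h t (interior_subset ht)
  have he : 3 ≤ Real.exp (a + b * t) := (Real.log_le_iff_le_exp (by norm_num)).1 hr
  apply div_nonneg _ (by positivity)
  generalize Real.exp (a + b * t) = E at *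
  generalize c + d * t = s at *
  nlinarith [mul_nonneg (by linarith : (0:ℝ) ≤ E) (sq_nonneg (b * s - 2 * d)),
    mul_nonneg (sub_nonneg.2 he) (sq_nonneg d)]

/-- The function `φ(r, ε) = (e^r − 1)/ε²` is convex on the region
`{(r, ε) : r ≥ log 3, ε > 0}`. -/
theorem phi_convexOn :
    ConvexOn ℝ {p : ℝ × ℝ | Real.log 3 ≤ p.1 ∧ 0 < p.2}
      (fun p : ℝ × ℝ => (Real.exp p.1 - 1) / p.2 ^ 2) := by
  have hc : Convex ℝ {p : ℝ × ℝ | Real.log 3 ≤ p.1 ∧ 0 < p.2} :=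
    (convex_halfSpace_ge (LinearMap.fst ℝ ℝ ℝ).isLinear _).inter
      (convex_halfSpace_gt (LinearMap.snd ℝ ℝ ℝ).isLinear _)
  refine ⟨hc, ?_⟩
  rintro ⟨r, x⟩ hp ⟨s, y⟩ hq u v hu hv huv
  have key := (phi_line r (s - r) x (y - x) (by
    rintro t ⟨h0, h1⟩
    have := hc hp hq (sub_nonneg.2 h1) h0 (by ring)
    simp only [Set.mem_ofPred_eq, Prod.smul_mk, Prod.mk_add_mk, smul_eq_mul] at this
    constructor
    · linarith [this.1]
    · linarith [this.2])).2 (x := 0) (y := 1) (by simp) (by simp) hu hv huv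
  obtain rfl : u = 1 - v := by linarith
  simp only [smul_eq_mul, Prod.smul_mk, Prod.mk_add_mk] at key ⊢
  convert key using 1 <;> ring_nf
end

section
/- There exists a unique real number β* > 1 satisfying log β* = 3·(β* − 1)/β*. Moreover 16 < β* < 17, and for every real β ≥ 2 one has f(β) ≥ f(β*), where f(β) := (β − 1)/(log β)³. -/
theorem aux_hasDeriv_g (x : ℝ) (hx : 0 < x) :
    HasDerivAt (fun x : ℝ => Real.log x - 3 + 3 / x) ((x - 3) / x ^ 2) x := by
  have h := ((Real.hasDerivAt_log hx.ne').sub_const 3).add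
    ((hasDerivAt_const x (3 : ℝ)).div (hasDerivAt_id x) hx.ne')
  refine h.congr_deriv ?_
  simp only [id]
  field_simp
  ring

theorem aux_hasDeriv_f (x : ℝ) (hx : 1 < x) :
    HasDerivAt (fun x : ℝ => (x - 1) / (Real.log x) ^ 3)
      ((Real.log x - 3 + 3 / x) / (Real.log x) ^ 4) x := by
  have hl : 0 < Real.log x := Real.log_pos hx
  have hx0 : x ≠ 0 := by positivity
  have h := ((hasDerivAt_id x).sub_const 1).div ((Real.hasDerivAt_log hx0).pow 3)
    (pow_ne_zero 3 hl.ne')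
  refine h.congr_deriv ?_
  simp only [id, Pi.pow_apply]
  field_simp
  push_cast
  ring

/-- There is a unique `β* > 1` with `log β* = 3(β*−1)/β*`; moreover
`16 < β* < 17`, and `β*` minimizes `f(β) = (β−1)/(log β)³` over `β ≥ 2`. -/
theorem optimal_real_branching_factor :
    ∃ βs : ℝ,
      (1 < βs ∧ Real.log βs = 3 * (βs - 1) / βs) ∧
      (∀ β : ℝ, 1 < β → Real.log β = 3 * (β - 1) / β → β = βs) ∧
      (16 < βs ∧ βs < 17) ∧
      (∀ β : ℝ, 2 ≤ β →
        (βs - 1) / (Real.log βs) ^ 3 ≤ (β - 1) / (Real.log β) ^ 3) := by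
  set g : ℝ → ℝ := fun x => Real.log x - 3 + 3 / x with hg
  have hl16 : Real.log 16 = 4 * Real.log 2 := by
    rw [show (16 : ℝ) = 2 ^ 4 by norm_num, Real.log_pow]; norm_num
  have h16 : g 16 < 0 := by
    have := Real.log_two_lt_d9
    simp only [hg, hl16]; norm_num; linarith
  have h17 : 0 < g 17 := by
    have := Real.log_two_gt_d9
    have h := Real.one_sub_inv_le_log_of_pos (show (0 : ℝ) < 17 / 16 by norm_num)
    rw [Real.log_div (by norm_num) (by norm_num), hl16] at h
    norm_num at h
    simp only [hg]; norm_num; linarith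
  have hanti : StrictAntiOn g (Set.Icc 1 3) := by
    apply strictAntiOn_of_deriv_neg (convex_Icc _ _)
    · intro x hx
      exact (aux_hasDeriv_g x (by linarith [hx.1])).continuousAt.continuousWithinAt
    · intro x hx
      rw [interior_Icc] at hx
      have h0 : 0 < x := by linarith [hx.1]
      rw [(aux_hasDeriv_g x h0).deriv]
      exact div_neg_of_neg_of_pos (by linarith [hx.2]) (by positivity)
  have hmono : StrictMonoOn g (Set.Ici 3) := by
    apply strictMonoOn_of_deriv_pos (convex_Ici _)
    · intro x hx
      have hx' : 3 ≤ x := hx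
      exact (aux_hasDeriv_g x (by linarith)).continuousAt.continuousWithinAt
    · intro x hx
      rw [interior_Ici] at hx
      have hx' : 3 < x := hx
      have h0 : 0 < x := by linarith
      rw [(aux_hasDeriv_g x h0).deriv]
      exact div_pos (by linarith) (by positivity)
  have hcont : ContinuousOn g (Set.Icc 16 17) := fun x hx =>
    (aux_hasDeriv_g x (by linarith [hx.1])).continuousAt.continuousWithinAt
  obtain ⟨b, ⟨hb1, hb2⟩, hb⟩ := intermediate_value_Ioo (by norm_num) hcont ⟨h16, h17⟩
  have hg1 : g 1 = 0 := by simp [hg]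
  have hneg : ∀ x, 1 < x → x < b → g x < 0 := by
    intro x h1 h2
    rcases le_total x 3 with h | h
    · have := hanti ⟨le_refl _, by norm_num⟩ ⟨h1.le, h⟩ h1
      linarith
    · have := hmono (show (3 : ℝ) ≤ x from h) (show (3 : ℝ) ≤ b by linarith) h2
      linarith
  have hpos : ∀ x, b < x → 0 < g x := by
    intro x h2
    have := hmono (show (3 : ℝ) ≤ b by linarith) (show (3 : ℝ) ≤ x by linarith) h2
    linarith
  have hiff : ∀ x, 1 < x → (Real.log x = 3 * (x - 1) / x ↔ g x = 0) := by
    intro x hx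
    have : 3 * (x - 1) / x = 3 - 3 / x := by field_simp
    rw [this]
    simp only [hg]
    constructor <;> intro h <;> linarith
  refine ⟨b, ⟨by linarith, (hiff b (by linarith)).2 hb⟩, ?_, ⟨hb1, hb2⟩, ?_⟩
  · intro x hx h
    have h0 := (hiff x hx).1 h
    rcases lt_trichotomy x b with h' | h' | h'
    · linarith [hneg x hx h']
    · exact h'
    · linarith [hpos x h']
  · intro x hx
    rcases le_total x b with h | h
    · have hA : AntitoneOn (fun x : ℝ => (x - 1) / (Real.log x) ^ 3) (Set.Icc 2 b) := by
        apply antitoneOn_of_deriv_nonpos (convex_Icc _ _)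
        · intro y hy
          exact (aux_hasDeriv_f y (by linarith [hy.1])).continuousAt.continuousWithinAt
        · intro y hy
          rw [interior_Icc] at hy
          exact (aux_hasDeriv_f y (by linarith [hy.1])).differentiableAt.differentiableWithinAt
        · intro y hy
          rw [interior_Icc] at hy
          have h1 : 1 < y := by linarith [hy.1]
          rw [(aux_hasDeriv_f y h1).deriv]
          exact div_nonpos_of_nonpos_of_nonneg (hneg y h1 hy.2).le (by positivity)
      exact hA ⟨hx, h⟩ ⟨by linarith, le_refl _⟩ h
    · have hA : MonotoneOn (fun x : ℝ => (x - 1) / (Real.log x) ^ 3) (Set.Ici b) := by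
        apply monotoneOn_of_deriv_nonneg (convex_Ici _)
        · intro y hy
          have hy' : b ≤ y := hy
          exact (aux_hasDeriv_f y (by linarith)).continuousAt.continuousWithinAt
        · intro y hy
          rw [interior_Ici] at hy
          have hy' : b < y := hy
          exact (aux_hasDeriv_f y (by linarith)).differentiableAt.differentiableWithinAt
        · intro y hy
          rw [interior_Ici] at hy
          have hy' : b < y := hy
          rw [(aux_hasDeriv_f y (by linarith)).deriv]
          exact div_nonneg (hpos y hy').le (by positivity)
      exact hA (le_refl b) h h
end

section
/- For every natural number n with n ≥ 2 and n ≠ 17, one has f(17) < f(n), where f(β) := (β − 1)/(log β)³; that is, 17 is the unique minimizer of f over the integers n ≥ 2. -/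
theorem aux_up (a b : ℝ) (ha : 0 < a) (hb : 0 < b) :
    Real.log b ≤ Real.log a + (b - a) / a := by
  have h := Real.log_le_sub_one_of_pos (div_pos hb ha)
  rw [Real.log_div hb.ne' ha.ne'] at h
  have : (b - a) / a = b / a - 1 := by field_simp
  linarith

theorem aux_mul (a b : ℝ) (ha : 0 < a) (hb : 0 < b) :
    Real.log (a * b) = Real.log a + Real.log b := Real.log_mul ha.ne' hb.ne'

theorem aux_17 : 2.83321 < Real.log 17 ∧ Real.log 17 < 2.83322 := by
  have h2 := Real.log_two_gt_d9
  have h2' := Real.log_two_lt_d9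
  have h3 := Real.log_three_gt_d9
  have h3' := Real.log_three_lt_d9
  have e : Real.log 289 = 2 * Real.log 17 := by
    rw [show (289:ℝ) = 17 ^ 2 by norm_num, Real.log_pow]; norm_num
  have e' : Real.log 288 = 5 * Real.log 2 + 2 * Real.log 3 := by
    rw [show (288:ℝ) = 2 ^ 5 * 3 ^ 2 by norm_num, aux_mul _ _ (by norm_num) (by norm_num),
      Real.log_pow, Real.log_pow]; norm_num
  have a1 := aux_up 288 289 (by norm_num) (by norm_num)
  have a2 := aux_up 289 288 (by norm_num) (by norm_num)
  norm_num at *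
  constructor <;> linarith

theorem aux_small (n : ℕ) (u : ℝ) (hn : 2 ≤ n) (hu : Real.log n ≤ u)
    (h : 16 * u ^ 3 < ((n:ℝ) - 1) * 2.83321 ^ 3) :
    ((17 : ℝ) - 1) / (Real.log 17) ^ 3 < ((n : ℝ) - 1) / (Real.log n) ^ 3 := by
  have h17 := aux_17.1
  have hn' : (2:ℝ) ≤ n := by exact_mod_cast hn
  have hp : 0 < Real.log n := Real.log_pos (by linarith)
  have h17p : 0 < Real.log 17 := by linarith
  rw [div_lt_div_iff₀ (by positivity) (by positivity)]
  have a : Real.log n ^ 3 ≤ u ^ 3 := by gcongr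
  have b : (2.83321:ℝ) ^ 3 ≤ Real.log 17 ^ 3 := by gcongr
  have c := mul_le_mul_of_nonneg_left b (show (0:ℝ) ≤ n - 1 by linarith)
  linarith

theorem aux_step (n : ℕ) (a : ℝ) (hn : 2 ≤ n) (ha : 0 < a) (hl : a ≤ Real.log n)
    (h : (1 + 1 / (n * a)) ^ 3 * ((n:ℝ) - 1) < n) :
    ((n : ℝ) - 1) / (Real.log n) ^ 3 < (((n + 1 : ℕ) : ℝ) - 1) / (Real.log (n + 1 : ℕ)) ^ 3 := by
  have hn' : (2:ℝ) ≤ n := by exact_mod_cast hn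
  have hp : 0 < Real.log n := by linarith
  have hq : 0 < Real.log (n + 1 : ℕ) := Real.log_pos (by push_cast; linarith)
  have hup := aux_up n (n + 1 : ℕ) (by linarith) (by positivity)
  have h1 : Real.log (n + 1 : ℕ) ≤ Real.log n * (1 + 1 / (n * a)) := by
    refine hup.trans ?_
    have : 1 / (n:ℝ) ≤ Real.log n * (1 / (n * a)) := by
      have : 1 / (n:ℝ) = a * (1 / (n * a)) := by field_simp
      rw [this]; gcongr
    push_cast
    rw [add_sub_cancel_left]
    linarith
  rw [div_lt_div_iff₀ (by positivity) (by positivity)]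
  have h2 : Real.log (n + 1 : ℕ) ^ 3 ≤ (Real.log n * (1 + 1 / (n * a))) ^ 3 := by gcongr
  have h3 := mul_le_mul_of_nonneg_left h2 (show (0:ℝ) ≤ n - 1 by linarith)
  have h4 := mul_lt_mul_of_pos_left h (show 0 < Real.log n ^ 3 by positivity)
  rw [mul_pow] at h3
  push_cast at *
  linarith

theorem aux_large (k : ℕ) :
    ((17 : ℝ) - 1) / (Real.log 17) ^ 3
      < (((18 + k : ℕ) : ℝ) - 1) / (Real.log (18 + k : ℕ)) ^ 3 := by
  have h2 := Real.log_two_gt_d9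
  have h2' := Real.log_two_lt_d9
  have h3 := Real.log_three_gt_d9
  have h3' := Real.log_three_lt_d9
  have e18 : Real.log 18 = Real.log 2 + 2 * Real.log 3 := by
    rw [show (18:ℝ) = 2 * 3 ^ 2 by norm_num, aux_mul _ _ (by norm_num) (by norm_num),
      Real.log_pow]; norm_num
  have a19 := aux_up 19 18 (by norm_num) (by norm_num)
  have a20 := aux_up 20 19 (by norm_num) (by norm_num)
  have a21 := aux_up 21 20 (by norm_num) (by norm_num)
  norm_num at h2 h2' h3 h3' a19 a20 a21
  induction k with
  | zero =>
    refine aux_small 18 2.8903718 (by norm_num) ?_ (by norm_num)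
    norm_num
    linarith
  | succ k ih =>
    refine ih.trans ?_
    rcases lt_or_ge k 3 with hk | hk
    · interval_cases k
      · exact aux_step 18 2.89037 (by norm_num) (by norm_num) (by norm_num; linarith) (by norm_num)
      · exact aux_step 19 2.94 (by norm_num) (by norm_num) (by norm_num; linarith) (by norm_num)
      · exact aux_step 20 2.99 (by norm_num) (by norm_num) (by norm_num; linarith) (by norm_num)
    · have hx : (21:ℝ) ≤ (18 + k : ℕ) := by exact_mod_cast (by omega : 21 ≤ 18 + k)
      have hl : (3:ℝ) ≤ Real.log (18 + k : ℕ) := by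
        have := Real.log_le_log (by norm_num) hx
        linarith
      refine aux_step (18 + k) 3 (by omega) (by norm_num) hl ?_
      generalize ((18 + k : ℕ) : ℝ) = x at hx
      have hx0 : 0 < x := by linarith
      have : (1 + 1 / (x * 3)) ^ 3 * (x - 1) = (3 * x + 1) ^ 3 * (x - 1) / (27 * x ^ 3) := by
        field_simp; ring
      rw [this, div_lt_iff₀ (by positivity)]
      nlinarith [pow_pos hx0 2, pow_pos hx0 3]

/-- `17` is the unique minimizer over the integers `n ≥ 2` of
`f(β) = (β − 1)/(log β)³`. -/
theorem optimal_integer_branching_factor (n : ℕ) (hn : 2 ≤ n) (hne : n ≠ 17) :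
    ((17 : ℝ) - 1) / (Real.log 17) ^ 3 < ((n : ℝ) - 1) / (Real.log n) ^ 3 := by
  rcases lt_or_ge n 18 with h | h
  · have h2' := Real.log_two_lt_d9
    have h3' := Real.log_three_lt_d9
    have m := aux_mul
    have e4 := m 2 2 (by norm_num) (by norm_num)
    have e6 := m 2 3 (by norm_num) (by norm_num)
    have e8 := m 2 4 (by norm_num) (by norm_num)
    have e9 := m 3 3 (by norm_num) (by norm_num)
    have e10 := m 2 5 (by norm_num) (by norm_num)
    have e12 := m 2 6 (by norm_num) (by norm_num)
    have e14 := m 2 7 (by norm_num) (by norm_num)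
    have e15 := m 3 5 (by norm_num) (by norm_num)
    have e16 := m 2 8 (by norm_num) (by norm_num)
    have e24 := m 2 12 (by norm_num) (by norm_num)
    have e25 := m 5 5 (by norm_num) (by norm_num)
    have e48 := m 2 24 (by norm_num) (by norm_num)
    have e49 := m 7 7 (by norm_num) (by norm_num)
    have a25 := aux_up 24 25 (by norm_num) (by norm_num)
    have a49 := aux_up 48 49 (by norm_num) (by norm_num)
    have a11 := aux_up 10 11 (by norm_num) (by norm_num)
    have a13 := aux_up 12 13 (by norm_num) (by norm_num)
    clear m
    norm_num at h2' h3' e4 e6 e8 e9 e10 e12 e14 e15 e16 e24 e25 e48 e49 a25 a49 a11 a13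
    interval_cases n
    · exact aux_small 2 0.6932 (by norm_num) (by norm_num; linarith) (by norm_num)
    · exact aux_small 3 1.0987 (by norm_num) (by norm_num; linarith) (by norm_num)
    · exact aux_small 4 1.3863 (by norm_num) (by norm_num; linarith) (by norm_num)
    · exact aux_small 5 1.6099 (by norm_num) (by norm_num; linarith) (by norm_num)
    · exact aux_small 6 1.7918 (by norm_num) (by norm_num; linarith) (by norm_num)
    · exact aux_small 7 1.9462 (by norm_num) (by norm_num; linarith) (by norm_num)
    · exact aux_small 8 2.0795 (by norm_num) (by norm_num; linarith) (by norm_num)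
    · exact aux_small 9 2.1973 (by norm_num) (by norm_num; linarith) (by norm_num)
    · exact aux_small 10 2.3031 (by norm_num) (by norm_num; linarith) (by norm_num)
    · exact aux_small 11 2.4032 (by norm_num) (by norm_num; linarith) (by norm_num)
    · exact aux_small 12 2.485 (by norm_num) (by norm_num; linarith) (by norm_num)
    · exact aux_small 13 2.5683 (by norm_num) (by norm_num; linarith) (by norm_num)
    · exact aux_small 14 2.6394 (by norm_num) (by norm_num; linarith) (by norm_num)
    · exact aux_small 15 2.7086 (by norm_num) (by norm_num; linarith) (by norm_num)
    · exact aux_small 16 2.77259 (by norm_num) (by norm_num; linarith) (by norm_num)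
    · exact absurd rfl hne
  · obtain ⟨k, rfl⟩ := Nat.exists_eq_add_of_le h
    exact aux_large k
end

section
/- Let p ≥ 2, m̄ ≥ 1, and t be natural numbers with t ≥ m̄, and write t = τ·m̄ + ρ where τ, ρ are the unique natural numbers with 0 ≤ ρ < m̄. Then for every tuple of natural numbers t_1, …, t_{m̄} with t_i ≥ 1 for all i and ∑_{i=1}^{m̄} t_i = t, one has ∑_{i=1}^{m̄} p^{t_i} ≥ (m̄ − ρ)·p^{τ} + ρ·p^{τ+1}. -/
lemma tangent_aux (p τ k : ℕ) (hp : 2 ≤ p) :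
    (p:ℤ) ^ τ + ((k:ℤ) - τ) * ((p:ℤ) ^ τ * ((p:ℤ) - 1)) ≤ (p:ℤ) ^ k := by
  have hp' : (2:ℤ) ≤ p := by exact_mod_cast hp
  rcases le_or_gt τ k with h | h
  · obtain ⟨d, rfl⟩ := Nat.exists_eq_add_of_le h
    have hb := one_add_mul_le_pow (a := (p:ℤ) - 1) (by linarith) d
    have h0 : (0:ℤ) ≤ (p:ℤ) ^ τ := by positivity
    have := mul_le_mul_of_nonneg_left hb h0
    rw [add_sub_cancel] at this
    rw [pow_add]
    push_cast
    linarith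
  · have h0 : (0:ℤ) ≤ (p:ℤ) ^ τ := by positivity
    have h1 : (0:ℤ) ≤ (p:ℤ) ^ k := by positivity
    have h2 : (1:ℤ) ≤ (τ:ℤ) - k := by omega
    have h3 : (1:ℤ) ≤ ((τ:ℤ) - k) * ((p:ℤ) - 1) := by nlinarith
    have := mul_le_mul_of_nonneg_left h3 h0
    linarith

/-- For `K̄ = p^t`, lower bound on `∑_i p^{t_i}` over exponent assignments
`t_i ≥ 1` with `∑ t_i = t`: writing `t = τ·m̄ + ρ` with `0 ≤ ρ < m̄`, the
minimum value is `(m̄ − ρ)·p^τ + ρ·p^{τ+1}`. -/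
theorem optimal_integer_exponents_lower_bound
    (p m t : ℕ) (hp : 2 ≤ p) (hm : 1 ≤ m) (ht : m ≤ t)
    (τ ρ : ℕ) (hρ : ρ < m) (htdecomp : t = τ * m + ρ)
    (te : Fin m → ℕ) (hte : ∀ i, 1 ≤ te i) (hsum : ∑ i, te i = t) :
    (m - ρ) * p ^ τ + ρ * p ^ (τ + 1) ≤ ∑ i, p ^ te i := by
  have key := Finset.sum_le_sum (s := Finset.univ)
    (fun i (_ : i ∈ Finset.univ) => tangent_aux p τ (te i) hp)
  have hs : ∑ i, (te i : ℤ) = τ * m + ρ := by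
    rw [htdecomp] at hsum
    exact_mod_cast hsum
  rw [Finset.sum_add_distrib, ← Finset.sum_mul, Finset.sum_sub_distrib, hs] at key
  simp only [Finset.sum_const, Finset.card_univ, Fintype.card_fin, nsmul_eq_mul] at key
  zify
  rw [Nat.cast_sub hρ.le]
  refine le_trans (le_of_eq ?_) key
  ring
end

section
/- Let p ≥ 2, m̄ ≥ 2, and t be natural numbers with t ≥ m̄, write t = τ·m̄ + ρ with 0 ≤ ρ < m̄, and suppose ρ ≠ 0 (i.e., m̄ does not divide t). If t_1 ≤ t_2 ≤ … ≤ t_{m̄} are natural numbers with t_i ≥ 1, ∑_{i=1}^{m̄} t_i = t, and ∑_{i=1}^{m̄} p^{t_i} = (m̄ − ρ)·p^{τ} + ρ·p^{τ+1}, then t_i = τ for 1 ≤ i ≤ m̄ − ρ and t_i = τ + 1 for m̄ − ρ < i ≤ m̄. -/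
theorem aux_bern (p : ℤ) (hp : 2 ≤ p) (d : ℕ) : 1 + ((d : ℤ) + 2) * (p - 1) < p ^ (d + 2) := by
  induction d with
  | zero => norm_num; nlinarith
  | succ d ih =>
    have h : p ^ (d + 1 + 2) = p ^ (d + 2) * p := by ring
    rw [h]
    push_cast
    have hd : (0 : ℤ) ≤ d := by positivity
    have h1 : (0 : ℤ) ≤ ((d : ℤ) + 2) * (p - 1) := mul_nonneg (by linarith) (by linarith)
    nlinarith [mul_nonneg h1 (by linarith : (0 : ℤ) ≤ p - 1)]

theorem aux_tangent (p : ℤ) (hp : 2 ≤ p) (τ k : ℕ) (h0 : k ≠ τ) (h1 : k ≠ τ + 1) :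
    p ^ τ + ((k : ℤ) - τ) * (p ^ (τ + 1) - p ^ τ) < p ^ k := by
  rcases lt_or_gt_of_ne h0 with h | h
  · obtain ⟨d, rfl⟩ := Nat.exists_eq_add_of_lt h
    have hk : 0 < p ^ k := by positivity
    have hτ : 0 < p ^ (k + d + 1) := by positivity
    have hd : (0 : ℤ) ≤ d := by positivity
    have e : p ^ (k + d + 1) + ((k : ℤ) - (k + d + 1 : ℕ)) * (p ^ (k + d + 1 + 1) - p ^ (k + d + 1))
        = p ^ (k + d + 1) * (1 - (d + 1) * (p - 1)) := by push_cast; ring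
    rw [e]
    have : 1 - ((d : ℤ) + 1) * (p - 1) ≤ 0 := by nlinarith
    nlinarith
  · obtain ⟨d, rfl⟩ : ∃ d, k = τ + (d + 2) := ⟨k - τ - 2, by omega⟩
    have hτ : 0 < p ^ τ := by positivity
    have e : p ^ τ + (((τ + (d + 2) : ℕ) : ℤ) - τ) * (p ^ (τ + 1) - p ^ τ)
        = p ^ τ * (1 + (d + 2) * (p - 1)) := by push_cast; ring
    rw [e, pow_add p τ (d + 2)]
    exact mul_lt_mul_of_pos_left (aux_bern p hp d) hτ

/-- Uniqueness of the optimal non-decreasing exponent assignment when `m̄` does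
not divide `t`: if `t_1 ≤ … ≤ t_m̄ ≥ 1` sum to `t = τ·m̄ + ρ` (with `0 < ρ < m̄`)
and achieve the optimal value `(m̄ − ρ)·p^τ + ρ·p^{τ+1}` of `∑_i p^{t_i}`, then
the first `m̄ − ρ` of them equal `τ` and the remaining `ρ` equal `τ + 1`. -/
theorem optimal_integer_exponents_unique
    (p m t : ℕ) (hp : 2 ≤ p) (hm : 2 ≤ m) (ht : m ≤ t)
    (τ ρ : ℕ) (hρlt : ρ < m) (hρne : ρ ≠ 0) (htdecomp : t = τ * m + ρ)
    (te : Fin m → ℕ) (hmono : Monotone te) (hte : ∀ i, 1 ≤ te i)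
    (hsum : ∑ i, te i = t)
    (hval : ∑ i, p ^ te i = (m - ρ) * p ^ τ + ρ * p ^ (τ + 1)) :
    ∀ i : Fin m,
      ((i : ℕ) < m - ρ → te i = τ) ∧ (m - ρ ≤ (i : ℕ) → te i = τ + 1) := by
  have hp' : (2 : ℤ) ≤ p := by exact_mod_cast hp
  have hle : ∀ i ∈ Finset.univ, (p : ℤ) ^ τ + ((te i : ℤ) - τ) * ((p : ℤ) ^ (τ + 1) - (p : ℤ) ^ τ)
      ≤ (p : ℤ) ^ te i := by
    intro i _
    by_cases h0 : te i = τ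
    · rw [h0]; simp
    by_cases h1 : te i = τ + 1
    · rw [h1]; push_cast; apply le_of_eq; ring
    exact (aux_tangent p hp' τ _ h0 h1).le
  have hsum' : ∑ i, (te i : ℤ) = τ * m + ρ := by
    rw [htdecomp] at hsum; exact_mod_cast hsum
  have hval' : ∑ i, (p : ℤ) ^ te i = ((m : ℤ) - ρ) * (p : ℤ) ^ τ + ρ * (p : ℤ) ^ (τ + 1) := by
    rw [← Nat.cast_sub hρlt.le]; exact_mod_cast hval
  have heq : ∑ i, ((p : ℤ) ^ τ + ((te i : ℤ) - τ) * ((p : ℤ) ^ (τ + 1) - (p : ℤ) ^ τ))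
      = ∑ i, (p : ℤ) ^ te i := by
    rw [hval', Finset.sum_add_distrib, ← Finset.sum_mul, Finset.sum_sub_distrib, hsum']
    simp
    ring
  have hall := (Finset.sum_eq_sum_iff_of_le hle).1 heq
  have hor : ∀ i, te i = τ ∨ te i = τ + 1 := by
    intro i
    by_contra hc
    push Not at hc
    exact (aux_tangent p hp' τ _ hc.1 hc.2).ne (hall i (Finset.mem_univ i))
  have hcard : (Finset.univ.filter (fun i => te i = τ + 1)).card = ρ := by
    have h1 : ∑ i, te i = ∑ i, (τ + if te i = τ + 1 then 1 else 0) := by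
      apply Finset.sum_congr rfl
      intro i _
      rcases hor i with h | h <;> simp [h]
    rw [Finset.sum_add_distrib, ← Finset.card_filter, hsum, htdecomp] at h1
    simp at h1
    rw [mul_comm] at h1
    omega
  intro i
  constructor
  · intro hi
    rcases hor i with h | h
    · exact h
    exfalso
    have hsub : Finset.Ici i ⊆ Finset.univ.filter (fun i => te i = τ + 1) := by
      intro j hj
      have := hmono (Finset.mem_Ici.1 hj)
      have := hor j
      simp
      omega
    have := Finset.card_le_card hsub
    rw [hcard, Fin.card_Ici] at this
    omega
  · intro hi
    rcases hor i with h | h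
    swap
    · exact h
    exfalso
    have hsub : Finset.univ.filter (fun i => te i = τ + 1) ⊆ Finset.Ioi i := by
      intro j hj
      simp at hj
      rw [Finset.mem_Ioi]
      by_contra hc
      have := hmono (not_lt.1 hc)
      omega
    have := Finset.card_le_card hsub
    rw [hcard, Fin.card_Ioi] at this
    have := i.2
    omega
end

section
/- Let b, m̃, K be natural numbers with b ≥ 17, m̃ ≥ 1, and K = b^{m̃}. Then for every natural number m̂ with 1 ≤ m̂ < m̃ and every tuple of natural numbers n_1, …, n_{m̂} with n_i ≥ 2 for all i and ∏_{i=1}^{m̂} n_i = K, one has m̂² · ∑_{i=1}^{m̂} (n_i − 1) > m̃³ · (b − 1). -/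
/-- If `K = b^m̃` with `b ≥ 17`, then every allocation of size `m̂ < m̃` has cost
strictly larger than `m̃³·(b − 1)`: the optimal tree height is at least `m̃`. -/
theorem height_lower_bound (b mt K : ℕ) (hb : 17 ≤ b) (hmt : 1 ≤ mt)
    (hK : K = b ^ mt)
    (mh : ℕ) (hmh1 : 1 ≤ mh) (hmh2 : mh < mt)
    (n : Fin mh → ℕ) (hn : ∀ i, 2 ≤ n i) (hprod : ∏ i, n i = K) :
    mt ^ 3 * (b - 1) < mh ^ 2 * ∑ i, (n i - 1) := by
  have hbR : (17:ℝ) ≤ b := by exact_mod_cast hb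
  have hb0 : (0:ℝ) < b := by linarith
  have hm0 : (0:ℝ) < mh := by exact_mod_cast hmh1
  have hmM : (mh:ℝ) < mt := by exact_mod_cast hmh2
  obtain ⟨L, hL⟩ : ∃ L, L = Real.log b := ⟨_, rfl⟩
  have hbL : (b:ℝ) = Real.exp L := by rw [hL, Real.exp_log hb0]
  -- lower bound on the logarithm
  have hlog17 : (2.83:ℝ) < Real.log 17 := by
    have h1 : Real.log 17 = 4 * Real.log 2 + Real.log (17/16) := by
      have : (17:ℝ) = 2^4 * (17/16) := by norm_num
      conv_lhs => rw [this]
      rw [Real.log_mul (by norm_num) (by norm_num), Real.log_pow]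
      norm_num
    have h2 := Real.one_sub_inv_le_log_of_pos (show (0:ℝ) < 17/16 by norm_num)
    have h3 := Real.log_two_gt_d9
    norm_num at h2 h3 ⊢
    linarith
  have hLb : Real.log 17 + 1 - 17 / b ≤ L := by
    have h1 := Real.one_sub_inv_le_log_of_pos (show (0:ℝ) < b/17 by positivity)
    rw [Real.log_div hb0.ne' (by norm_num), inv_div, ← hL] at h1
    linarith
  have hdiv : 17 / (b:ℝ) ≤ 1 := by rw [div_le_one hb0]; exact hbR
  have hL28 : 2.83 < L := by linarith
  have hkey : 3 * ((b:ℝ) - 1) < b * L := by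
    have h1 : (b:ℝ) * (Real.log 17 + 1 - 17 / b) ≤ b * L := by gcongr
    have h2 : (b:ℝ) * (Real.log 17 + 1 - 17 / b) = b * (Real.log 17 + 1) - 17 := by
      field_simp
    nlinarith
  -- the ratio
  obtain ⟨s, hs⟩ : ∃ s : ℝ, s = mt / mh - 1 := ⟨_, rfl⟩
  have hs0 : 0 < s := by
    rw [hs, sub_pos, lt_div_iff₀ hm0]; linarith
  have hM : (mt:ℝ) = mh * (1 + s) := by rw [hs]; field_simp; ring
  have hexp : 1 + s*L + (s*L)^2/2 + (s*L)^3/6 ≤ Real.exp (s*L) := by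
    have := Real.sum_le_exp_of_nonneg (x := s*L) (by positivity) 4
    simp [Finset.sum_range_succ, Nat.factorial] at this
    linarith
  have hc : Real.exp ((1+s)*L) = b * Real.exp (s*L) := by
    rw [hbL, ← Real.exp_add]; ring_nf
  have hmain : (1+s)^3 * ((b:ℝ) - 1) < Real.exp ((1+s)*L) - 1 := by
    rw [hc]
    have h1 : (b:ℝ) * (1 + s*L + (s*L)^2/2 + (s*L)^3/6) ≤ b * Real.exp (s*L) := by gcongr
    have hLL : 6 ≤ L^2 := by nlinarith
    have hLLL : 6 ≤ L^3 := by nlinarith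
    have a1 : s * (3 * ((b:ℝ) - 1)) < s * (b*L) := by gcongr
    have a2 : s^2 * b * 6 ≤ s^2 * b * L^2 := by gcongr
    have a3 : s^3 * b * 6 ≤ s^3 * b * L^3 := by gcongr
    have := pow_pos hs0 2
    have := pow_pos hs0 3
    nlinarith
  -- AM-GM
  have hsumlog : ∑ i, Real.log (n i) = mh * ((1+s)*L) := by
    rw [← Real.log_prod (fun i _ => by have := hn i; positivity)]
    rw [← Nat.cast_prod, hprod, hK, Nat.cast_pow, Real.log_pow, ← hL, hM]; ring
  have hsum : mh * Real.exp ((1+s)*L) ≤ ∑ i, (n i : ℝ) := by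
    have h1 : ∀ i, Real.exp ((1+s)*L) * (Real.log (n i) - (1+s)*L + 1) ≤ n i := by
      intro i
      have hp : (0:ℝ) < n i := by have := hn i; positivity
      calc _ ≤ Real.exp ((1+s)*L) * Real.exp (Real.log (n i) - (1+s)*L) := by
            gcongr; exact Real.add_one_le_exp _
        _ = n i := by rw [← Real.exp_add, add_sub_cancel, Real.exp_log hp]
    have h2 := Finset.sum_le_sum (fun i (_ : i ∈ Finset.univ) => h1 i)
    rw [← Finset.mul_sum, Finset.sum_add_distrib, Finset.sum_sub_distrib, hsumlog] at h2
    simp at h2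
    linarith
  have hcast : ((∑ i, (n i - 1) : ℕ) : ℝ) = ∑ i, (n i : ℝ) - mh := by
    rw [Nat.cast_sum]
    rw [Finset.sum_congr rfl (fun i _ => Nat.cast_sub (show 1 ≤ n i by have := hn i; omega))]
    simp
  have : ((mt ^ 3 * (b - 1) : ℕ) : ℝ) < ((mh ^ 2 * ∑ i, (n i - 1) : ℕ) : ℝ) := by
    rw [Nat.cast_mul, Nat.cast_mul, hcast, Nat.cast_sub (by omega), Nat.cast_pow, Nat.cast_pow, hM]
    calc ((mh:ℝ) * (1+s))^3 * ((b:ℝ) - (1:ℕ)) = mh^3 * ((1+s)^3 * ((b:ℝ) - 1)) := by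
          push_cast; ring
      _ < mh^3 * (Real.exp ((1+s)*L) - 1) := by gcongr
      _ = mh^2 * (mh * Real.exp ((1+s)*L) - mh) := by ring
      _ ≤ _ := by gcongr
  exact_mod_cast this
end

section
/- Let b, m̃, K be natural numbers with 2 ≤ b ≤ 16, m̃ ≥ 1, and K = b^{m̃}. Then for every natural number m̂ with m̂ > m̃ and every tuple of natural numbers n_1, …, n_{m̂} with n_i ≥ 2 for all i and ∏_{i=1}^{m̂} n_i = K, one has m̂² · ∑_{i=1}^{m̂} (n_i − 1) > m̃³ · (b − 1). -/
lemma aux_phi (s : ℝ) (h0 : 0 < s) (h1 : s ≤ Real.log 16) :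
    s * Real.exp s < 3 * (Real.exp s - 1) := by
  have hL : Real.log 16 < 45 / 16 := by
    have : (16:ℝ) = 2 ^ 4 := by norm_num
    rw [this, Real.log_pow]
    have := Real.log_two_lt_d9
    push_cast
    linarith
  have hLpos : 0 < Real.log 16 := lt_of_lt_of_le h0 h1
  obtain ⟨l, hl⟩ : ∃ l, l = s / Real.log 16 := ⟨_, rfl⟩
  have hls : s = l * Real.log 16 := by rw [hl]; field_simp
  have hl0 : 0 < l := by rw [hl]; positivity
  have hl1 : l ≤ 1 := by rw [hl]; exact (div_le_one hLpos).2 h1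
  have hc := convexOn_exp.2 (Set.mem_univ (0:ℝ)) (Set.mem_univ (-Real.log 16))
    (show 0 ≤ 1 - l by linarith) hl0.le (by ring)
  simp only [smul_eq_mul, Real.exp_zero, Real.exp_neg] at hc
  rw [Real.exp_log (by norm_num)] at hc
  have he : (1 - l) * 0 + l * -Real.log 16 = -s := by rw [hls]; ring
  rw [he] at hc
  have h3 : 3 * Real.exp (-s) < 3 - s := by
    have : l * Real.log 16 < l * (45/16) := mul_lt_mul_of_pos_left hL hl0
    linarith
  have h4 := mul_lt_mul_of_pos_right h3 (Real.exp_pos s)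
  rw [mul_assoc, ← Real.exp_add] at h4
  simp at h4
  linarith

lemma aux_anti : StrictAntiOn (fun s : ℝ => (Real.exp s - 1) / s ^ 3) (Set.Ioc 0 (Real.log 16)) := by
  have hd : ∀ s : ℝ, 0 < s → HasDerivAt (fun s : ℝ => (Real.exp s - 1) / s ^ 3)
      ((Real.exp s * s ^ 3 - (Real.exp s - 1) * (3 * s ^ 2)) / (s ^ 3) ^ 2) s := by
    intro s hs
    have := ((Real.hasDerivAt_exp s).sub_const 1).div (hasDerivAt_pow 3 s) (by positivity)
    norm_num at this
    exact this
  apply strictAntiOn_of_deriv_neg (convex_Ioc _ _)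
  · intro s hs
    exact (hd s hs.1).continuousAt.continuousWithinAt
  · intro s hs
    rw [interior_Ioc] at hs
    rw [(hd s hs.1).deriv]
    have h := aux_phi s hs.1 hs.2.le
    have h0 : 0 < s := hs.1
    apply div_neg_of_neg_of_pos _ (by positivity)
    have := mul_lt_mul_of_pos_left h (pow_pos h0 2)
    nlinarith

/-- If `K = b^m̃` with `2 ≤ b ≤ 16`, then every allocation of size `m̂ > m̃` has
cost strictly larger than `m̃³·(b − 1)`: the optimal tree height is at most
`m̃`. -/
theorem height_upper_bound (b mt K : ℕ) (hb2 : 2 ≤ b) (hb16 : b ≤ 16)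
    (hmt : 1 ≤ mt) (hK : K = b ^ mt)
    (mh : ℕ) (hmh : mt < mh)
    (n : Fin mh → ℕ) (hn : ∀ i, 2 ≤ n i) (hprod : ∏ i, n i = K) :
    mt ^ 3 * (b - 1) < mh ^ 2 * ∑ i, (n i - 1) := by
  have hb : (2:ℝ) ≤ b := by exact_mod_cast hb2
  have hb' : (b:ℝ) ≤ 16 := by exact_mod_cast hb16
  have hm : (1:ℝ) ≤ mt := by exact_mod_cast hmt
  have hmm : (mt:ℝ) < mh := by exact_mod_cast hmh
  have hh : (0:ℝ) < mh := by linarith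
  have hS0 : 0 < Real.log b := Real.log_pos (by linarith)
  have hS1 : Real.log b ≤ Real.log 16 := Real.log_le_log (by linarith) hb'
  obtain ⟨c, hc⟩ : ∃ c, c = mt * Real.log b / mh := ⟨_, rfl⟩
  have hmc : mh * c = mt * Real.log b := by rw [hc]; field_simp
  have hc0 : 0 < c := by rw [hc]; positivity
  have hcS : c < Real.log b := by
    rw [hc, div_lt_iff₀ hh, mul_comm]
    exact mul_lt_mul_of_pos_left hmm hS0
  have hlog : ∑ i, Real.log (n i) = mh * c := by
    rw [hmc, ← Real.log_pow, ← Real.log_prod]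
    · congr 1
      rw [hK] at hprod
      exact_mod_cast hprod
    · intro i _
      have := hn i
      positivity
  have hsum : mh * (Real.exp c - 1) ≤ ∑ i, ((n i : ℝ) - 1) := by
    have h1 : ∀ i, Real.exp c * (1 + Real.log (n i) - c) ≤ n i := by
      intro i
      have hp : (0:ℝ) < n i := by have := hn i; positivity
      have h2 := Real.add_one_le_exp (Real.log (n i) - c)
      have h3 := mul_le_mul_of_nonneg_left h2 (Real.exp_pos c).le
      rw [← Real.exp_add, add_sub_cancel, Real.exp_log hp] at h3
      linarith
    have h2 := Finset.sum_le_sum (fun i (_ : i ∈ Finset.univ) => h1 i)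
    rw [← Finset.mul_sum, Finset.sum_sub_distrib, Finset.sum_add_distrib, hlog] at h2
    simp at h2
    simp
    linarith
  have ha := aux_anti ⟨hc0, hcS.le.trans hS1⟩ ⟨hS0, hS1⟩ hcS
  simp only at ha
  rw [Real.exp_log (by linarith), div_lt_div_iff₀ (by positivity) (by positivity)] at ha
  have hkey : (mt:ℝ) ^ 3 * (b - 1) < mh ^ 3 * (Real.exp c - 1) := by
    have h1 := mul_lt_mul_of_pos_right ha (pow_pos hh 3)
    have h2 : ((b:ℝ) - 1) * c ^ 3 * mh ^ 3 = (mt ^ 3 * (b - 1)) * Real.log b ^ 3 := by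
      rw [mul_assoc, ← mul_pow, mul_comm c, hmc]; ring
    rw [h2] at h1
    refine lt_of_mul_lt_mul_right (a := Real.log b ^ 3) ?_ (by positivity)
    linarith
  have hfin : (mt:ℝ) ^ 3 * (b - 1) < mh ^ 2 * ∑ i, ((n i : ℝ) - 1) := by
    have := mul_le_mul_of_nonneg_left hsum (pow_pos hh 2).le
    nlinarith
  have e1 : ((b - 1 : ℕ) : ℝ) = (b:ℝ) - 1 := by
    rw [Nat.cast_sub (by omega)]; simp
  have e2 : ((∑ i, (n i - 1) : ℕ) : ℝ) = ∑ i, ((n i : ℝ) - 1) := by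
    rw [Nat.cast_sum]
    refine Finset.sum_congr rfl fun i _ => ?_
    rw [Nat.cast_sub (by have := hn i; omega)]; simp
  rw [← e1, ← e2] at hfin
  exact_mod_cast hfin
end

section
/- Let p be a prime with p ≥ 17, let t ≥ 1 be a natural number, and let K = p^t. Then for every natural number m̄ ≥ 1 and every tuple of natural numbers n_1, …, n_{m̄} with n_i ≥ 2 for all i and ∏_{i=1}^{m̄} n_i = K, one has m̄² · ∑_{i=1}^{m̄} (n_i − 1) ≥ t³ · (p − 1), with equality if and only if m̄ = t and n_i = p for all i. -/
lemma aux_cube (p : ℕ) (hp : 17 ≤ p) (b : ℕ) : (b+2)^3 ≤ p^(b+1) := by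
  induction b with
  | zero => simp; omega
  | succ b ih =>
    calc (b+1+2)^3 ≤ (b+2)^3 * 17 := by ring_nf; nlinarith [sq_nonneg b]
      _ ≤ p^(b+1) * p := Nat.mul_le_mul ih hp
      _ = _ := by ring

lemma aux_lt (p : ℕ) (hp : 17 ≤ p) (a : ℕ) (ha : 2 ≤ a) : a^3 * (p-1) < p^a - 1 := by
  obtain ⟨b, rfl⟩ := Nat.exists_eq_add_of_le' ha
  have h := aux_cube p hp b
  have h8 : 2^3 ≤ (b+2)^3 := Nat.pow_le_pow_left (by omega) 3
  have h2 : (b+2)^3 * p ≤ p^(b+2) := by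
    calc _ ≤ p^(b+1) * p := Nat.mul_le_mul_right _ h
      _ = _ := by ring
  have h3 : (b+2)^3 * (p-1) + (b+2)^3 = (b+2)^3 * p := by
    rw [← Nat.mul_succ]; congr 1; omega
  omega

lemma aux_le (p : ℕ) (hp : 17 ≤ p) (a : ℕ) (ha : 1 ≤ a) : a^3 * (p-1) ≤ p^a - 1 := by
  rcases Nat.lt_or_ge a 2 with h | h
  · obtain rfl : a = 1 := by omega
    simp
  · exact (aux_lt p hp a h).le

lemma aux_pm (m : ℕ) (hm : 1 ≤ m) (a : Fin m → ℕ) : (∑ i, a i)^3 ≤ m^2 * ∑ i, (a i)^3 := by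
  have h := pow_sum_div_card_le_sum_pow (s := Finset.univ) (f := fun i => (a i : ℚ))
    (fun i _ => by positivity) 2
  rw [div_le_iff₀' (by simp; positivity)] at h
  simp only [Finset.card_univ, Fintype.card_fin] at h
  exact_mod_cast h

theorem optimal_height_prime_ge17 (p : ℕ) (hp : p.Prime) (hp17 : 17 ≤ p)
    (t : ℕ) (ht : 1 ≤ t) (K : ℕ) (hK : K = p ^ t)
    (m : ℕ) (hm : 1 ≤ m)
    (n : Fin m → ℕ) (hn : ∀ i, 2 ≤ n i) (hprod : ∏ i, n i = K) :
    t ^ 3 * (p - 1) ≤ m ^ 2 * ∑ i, (n i - 1) ∧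
    (m ^ 2 * ∑ i, (n i - 1) = t ^ 3 * (p - 1) ↔ m = t ∧ ∀ i, n i = p) := by
  have h1 : ∀ i, ∃ k, n i = p ^ k := fun i => by
    have : n i ∣ p ^ t := by rw [← hK, ← hprod]; exact Finset.dvd_prod_of_mem n (Finset.mem_univ i)
    obtain ⟨k, _, hk⟩ := (Nat.dvd_prime_pow hp).1 this
    exact ⟨k, hk⟩
  choose a ha using h1
  have ha1 : ∀ i, 1 ≤ a i := fun i => by
    by_contra h
    have h0 : a i = 0 := by omega
    have := hn i
    rw [ha i, h0] at this
    simp at this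
  have hsum : ∑ i, a i = t := by
    apply Nat.pow_right_injective hp.two_le
    simp only
    rw [← Finset.prod_pow_eq_pow_sum, ← hK, ← hprod]
    exact Finset.prod_congr rfl fun i _ => (ha i).symm
  have hle : ∀ i, (a i)^3 * (p-1) ≤ n i - 1 := fun i => by
    rw [ha i]; exact aux_le p hp17 _ (ha1 i)
  have hpm := Nat.mul_le_mul_right (p-1) (aux_pm m hm a)
  rw [hsum, mul_assoc, Finset.sum_mul] at hpm
  have hS : ∑ i, (a i)^3 * (p-1) ≤ ∑ i, (n i - 1) := Finset.sum_le_sum fun i _ => hle i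
  refine ⟨hpm.trans (Nat.mul_le_mul_left _ hS), ?_, ?_⟩
  · intro heq
    have hS' : ∑ i, (n i - 1) ≤ ∑ i, (a i)^3 * (p-1) := by
      rw [← heq] at hpm
      exact Nat.le_of_mul_le_mul_left hpm (by positivity)
    have hall := (Finset.sum_eq_sum_iff_of_le fun i _ => hle i).1 (le_antisymm hS hS')
    have hone : ∀ i, a i = 1 := fun i => by
      by_contra h
      have h2 := aux_lt p hp17 (a i) (by have := ha1 i; omega)
      have h3 := hall i (Finset.mem_univ i)
      rw [← ha i] at h2
      omega
    refine ⟨?_, fun i => by rw [ha i, hone i, pow_one]⟩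
    rw [← hsum]; simp [hone]
  · rintro ⟨rfl, h⟩
    simp [h]; ring
end

section
/- Let K, b₁, b₂, m̄₁, m̄₂ be natural numbers with K ≥ 2, b₁ ≥ 17, 2 ≤ b₂ ≤ 16, m̄₁ ≥ 1, m̄₂ ≥ 1, b₁^{m̄₁} = K, and b₂^{m̄₂} = K. Then for every natural number m̄ with m̄ < m̄₁ or m̄ > m̄₂, and every tuple of natural numbers n_1, …, n_{m̄} with n_i ≥ 2 for all i and ∏_{i=1}^{m̄} n_i = K, one has m̄² · ∑_{i=1}^{m̄} (n_i − 1) > min( m̄₁³·(b₁ − 1), m̄₂³·(b₂ − 1) ). -/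
noncomputable def hgt (t : ℝ) : ℝ := (Real.exp t - 1) / t ^ 3

lemma hgt_hasDeriv (t : ℝ) (ht : 0 < t) :
    HasDerivAt hgt ((Real.exp t * (t - 3) + 3) / t ^ 4) t := by
  have h := ((Real.hasDerivAt_exp t).sub_const 1).div (hasDerivAt_pow 3 t) (by positivity)
  refine h.congr_deriv ?_
  field_simp
  push_cast
  ring

lemma log16_lt : Real.log 16 < 2.7726 := by
  have : Real.log 16 = 4 * Real.log 2 := by
    rw [show (16 : ℝ) = 2 ^ 4 by norm_num, Real.log_pow]; norm_num
  rw [this]; linarith [Real.log_two_lt_d9]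

lemma log17_gt : 2.83 < Real.log 17 := by
  have h : Real.log 16 = 4 * Real.log 2 := by
    rw [show (16 : ℝ) = 2 ^ 4 by norm_num, Real.log_pow]; norm_num
  have h2 : Real.log (16 / 17) ≤ 16 / 17 - 1 := Real.log_le_sub_one_of_pos (by norm_num)
  rw [Real.log_div (by norm_num) (by norm_num)] at h2
  linarith [Real.log_two_gt_d9]

lemma psi_pos (t : ℝ) (ht : Real.log 17 < t) : 0 < Real.exp t * (t - 3) + 3 := by
  have hb : 17 < Real.exp t := (Real.log_lt_iff_lt_exp (by norm_num)).1 ht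
  have h := Real.log_le_sub_one_of_pos (show 0 < 17 / Real.exp t by positivity)
  rw [Real.log_div (by norm_num) (by positivity), Real.log_exp] at h
  set b := Real.exp t
  have h2 : 17 / b * b = 17 := by field_simp
  nlinarith [log17_gt]

lemma psi_neg (t : ℝ) (h0 : 0 < t) (ht : t < Real.log 16) : Real.exp t * (t - 3) + 3 < 0 := by
  have hb : Real.exp t < 16 := (Real.lt_log_iff_exp_lt (by norm_num)).1 ht
  have h1 : 1 < Real.exp t := Real.one_lt_exp_iff.2 h0
  by_cases h3 : Real.exp t < 3
  · have := Real.log_le_sub_one_of_pos (Real.exp_pos t)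
    rw [Real.log_exp] at this
    nlinarith
  · have h := Real.log_le_sub_one_of_pos (show 0 < Real.exp t / 16 by positivity)
    rw [Real.log_div (by positivity) (by norm_num), Real.log_exp] at h
    have := log16_lt
    have : t - 3 ≤ Real.exp t / 16 - 1.2274 := by linarith
    nlinarith

lemma hgt_mono : StrictMonoOn hgt (Set.Ici (Real.log 17)) := by
  have hp : 0 < Real.log 17 := Real.log_pos (by norm_num)
  apply strictMonoOn_of_deriv_pos (convex_Ici _)
  · intro t ht
    exact (hgt_hasDeriv t (lt_of_lt_of_le hp ht)).continuousAt.continuousWithinAt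
  · intro t ht
    rw [interior_Ici] at ht
    have h0 : 0 < t := lt_trans hp ht
    rw [(hgt_hasDeriv t h0).deriv]
    have := psi_pos t ht
    positivity

lemma hgt_anti : StrictAntiOn hgt (Set.Ioc 0 (Real.log 16)) := by
  apply strictAntiOn_of_deriv_neg (convex_Ioc _ _)
  · intro t ht
    exact (hgt_hasDeriv t ht.1).continuousAt.continuousWithinAt
  · intro t ht
    rw [interior_Ioc] at ht
    rw [(hgt_hasDeriv t ht.1).deriv]
    exact div_neg_of_neg_of_pos (psi_neg t ht.1 ht.2) (pow_pos ht.1 4)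

lemma unif_cost (K b m : ℕ) (hb : 2 ≤ b) (hm : 1 ≤ m) (h : b ^ m = K) :
    Real.log b = Real.log K / m ∧
    ((m ^ 3 * (b - 1) : ℕ) : ℝ) = Real.log K ^ 3 * hgt (Real.log b) := by
  have hm' : (0 : ℝ) < m := by exact_mod_cast hm
  have hb' : (1 : ℝ) < b := by exact_mod_cast hb
  have hl : 0 < Real.log b := Real.log_pos hb'
  have hK : Real.log K = m * Real.log b := by rw [← h]; push_cast; rw [Real.log_pow]
  refine ⟨by rw [hK]; field_simp, ?_⟩
  rw [hK, hgt, Real.exp_log (by linarith)]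
  push_cast [Nat.cast_sub (show 1 ≤ b by omega)]
  field_simp

lemma cost_lower (K m : ℕ) (hm : 0 < m) (hK : 2 ≤ K) (n : Fin m → ℕ) (hn : ∀ i, 2 ≤ n i)
    (hprod : ∏ i, n i = K) :
    Real.log K ^ 3 * hgt (Real.log K / m) ≤ ((m ^ 2 * ∑ i, (n i - 1) : ℕ) : ℝ) := by
  have hm' : (0 : ℝ) < m := by exact_mod_cast hm
  have hl : 0 < Real.log K := Real.log_pos (by exact_mod_cast hK)
  have hsum : Real.log K = ∑ i, Real.log (n i) := by
    rw [← hprod]; push_cast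
    exact Real.log_prod (fun i _ => by have := hn i; positivity)
  set s := Real.log K / m with hs
  have hle : ∀ i, Real.exp s * (1 + Real.log (n i) - s) - 1 ≤ ((n i - 1 : ℕ) : ℝ) := by
    intro i
    have h2 := hn i
    have hpos : (0 : ℝ) < n i := by positivity
    rw [Nat.cast_sub (by omega)]
    have h := Real.add_one_le_exp (Real.log (n i) - s)
    have h3 : Real.exp s * Real.exp (Real.log (n i) - s) = n i := by
      rw [← Real.exp_add, add_sub_cancel, Real.exp_log hpos]
    have := mul_le_mul_of_nonneg_left h (Real.exp_pos s).le
    push_cast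
    linarith
  have hS := Finset.sum_le_sum (fun i (_ : i ∈ Finset.univ) => hle i)
  have hE : ∑ i, (Real.exp s * (1 + Real.log (n i) - s) - 1) = m * (Real.exp s - 1) := by
    rw [Finset.sum_sub_distrib, ← Finset.mul_sum, Finset.sum_sub_distrib, Finset.sum_add_distrib,
      ← hsum]
    simp
    have : Real.log K = m * s := by rw [hs]; field_simp
    rw [this]; ring
  rw [hE] at hS
  have : Real.log K ^ 3 * hgt s = (m : ℝ) ^ 2 * (m * (Real.exp s - 1)) := by
    rw [hgt]
    have h1 : Real.log K = m * s := by rw [hs]; field_simp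
    have : 0 < s := by positivity
    rw [h1]; field_simp
  rw [this]
  push_cast
  exact mul_le_mul_of_nonneg_left (by exact_mod_cast hS) (by positivity)


/-- If `K = b₁^m̄₁ = b₂^m̄₂` with `b₁ ≥ 17` and `2 ≤ b₂ ≤ 16`, then every
allocation of size `m̄ < m̄₁` or `m̄ > m̄₂` has cost strictly larger than the
smaller of the costs `m̄₁³·(b₁ − 1)` and `m̄₂³·(b₂ − 1)` of the two uniform
allocations: an error-optimal tree height lies between `m̄₁` and `m̄₂`. -/
theorem optimal_height_between (K b1 b2 m1 m2 : ℕ) (hK : 2 ≤ K)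
    (hb1 : 17 ≤ b1) (hb2l : 2 ≤ b2) (hb2u : b2 ≤ 16)
    (hm1 : 1 ≤ m1) (hm2 : 1 ≤ m2)
    (hKb1 : b1 ^ m1 = K) (hKb2 : b2 ^ m2 = K)
    (m : ℕ) (hm : m < m1 ∨ m2 < m)
    (n : Fin m → ℕ) (hn : ∀ i, 2 ≤ n i) (hprod : ∏ i, n i = K) :
    min (m1 ^ 3 * (b1 - 1)) (m2 ^ 3 * (b2 - 1)) < m ^ 2 * ∑ i, (n i - 1) := by
  have hmpos : 0 < m := by
    rcases Nat.eq_zero_or_pos m with h | h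
    · subst h; simp at hprod; omega
    · exact h
  have hl : 0 < Real.log K := Real.log_pos (by exact_mod_cast hK)
  have hm' : (0 : ℝ) < m := by exact_mod_cast hmpos
  have hlow := cost_lower K m hmpos hK n hn hprod
  have hl3 : 0 < Real.log K ^ 3 := by positivity
  rcases hm with h | h
  · refine lt_of_le_of_lt (min_le_left _ _) ?_
    obtain ⟨e1, e2⟩ := unif_cost K b1 m1 (by omega) hm1 hKb1
    have h17 : Real.log 17 ≤ Real.log b1 :=
      Real.log_le_log (by norm_num) (by exact_mod_cast hb1)
    have hlt : Real.log b1 < Real.log K / m := by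
      rw [e1]
      exact div_lt_div_of_pos_left hl hm' (by exact_mod_cast h)
    have := mul_lt_mul_of_pos_left (hgt_mono h17 (h17.trans hlt.le) hlt) hl3
    have : ((m1 ^ 3 * (b1 - 1) : ℕ) : ℝ) < ((m ^ 2 * ∑ i, (n i - 1) : ℕ) : ℝ) := by
      rw [e2]; linarith
    exact_mod_cast this
  · refine lt_of_le_of_lt (min_le_right _ _) ?_
    obtain ⟨e1, e2⟩ := unif_cost K b2 m2 hb2l hm2 hKb2
    have h16 : Real.log b2 ≤ Real.log 16 :=
      Real.log_le_log (by positivity) (by exact_mod_cast hb2u)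
    have hlt : Real.log K / m < Real.log b2 := by
      rw [e1]
      exact div_lt_div_of_pos_left hl (by exact_mod_cast hm2) (by exact_mod_cast h)
    have h0 : 0 < Real.log K / m := by positivity
    have := mul_lt_mul_of_pos_left
      (hgt_anti ⟨h0, hlt.le.trans h16⟩ ⟨h0.trans hlt, h16⟩ hlt) hl3
    have : ((m2 ^ 3 * (b2 - 1) : ℕ) : ℝ) < ((m ^ 2 * ∑ i, (n i - 1) : ℕ) : ℝ) := by
      rw [e2]; linarith
    exact_mod_cast this
end

section
/- For every prime t with t ≥ 11, there exist a natural number m̄ and a tuple of natural numbers n_1, …, n_{m̄} with n_i ≥ 2 for all i, ∏_{i=1}^{m̄} n_i = 2^t, and the n_i not all equal, such that m̄² · ∑_{i=1}^{m̄} (n_i − 1) < (1/3)·t³ and m̄² · ∑_{i=1}^{m̄} (n_i − 1) < (1/3)·(2^t − 1). -/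
lemma cube_lt_two_pow_aux (t : ℕ) (h : 11 ≤ t) : t ^ 3 + 1 ≤ 2 ^ t := by
  induction t, h using Nat.le_induction with
  | base => norm_num
  | succ k hk ih =>
    rw [pow_succ 2 k]
    nlinarith [Nat.mul_le_mul hk hk, Nat.mul_le_mul_right (k ^ 2) hk]

/-- For `K = 2^t` with `t ≥ 11` prime, there is an allocation with not-all-equal
branching factors whose cost is less than a third of the cost `t³` of the
binary tree and less than a third of the cost `2^t − 1` of the single-level
tree. -/
theorem unequal_branching_beats_equal (t : ℕ) (ht : t.Prime) (ht11 : 11 ≤ t) :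
    ∃ (m : ℕ) (n : Fin m → ℕ),
      (∀ i, 2 ≤ n i) ∧ (∏ i, n i = 2 ^ t) ∧ (∃ i j, n i ≠ n j) ∧
      ((m : ℝ) ^ 2 * ∑ i, ((n i : ℝ) - 1) < (1 / 3) * (t : ℝ) ^ 3) ∧
      ((m : ℝ) ^ 2 * ∑ i, ((n i : ℝ) - 1) < (1 / 3) * ((2 : ℝ) ^ t - 1)) := by
  have h3 : ¬ 3 ∣ t := fun h => by
    have := (Nat.prime_dvd_prime_iff_eq Nat.prime_three ht).1 h
    omega
  have hc : (t : ℝ) ^ 3 + 1 ≤ 2 ^ t := by exact_mod_cast cube_lt_two_pow_aux t ht11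
  suffices H : ∃ q r : ℕ, t = 3 * q + r ∧ 1 ≤ q ∧ 1 ≤ r ∧ r < 3 ∧
      3 * (((q : ℝ) + 1) ^ 2 * ((2 ^ r - 1) + q * 7)) < (t : ℝ) ^ 3 by
    obtain ⟨q, r, htq, hq, hr, hr3, hlt⟩ := H
    have hs : (((q + 1 : ℕ) : ℝ) ^ 2 * ∑ i, (((Fin.cons (2 ^ r) (fun _ : Fin q => 8) :
        Fin (q + 1) → ℕ) i : ℝ) - 1)) = ((q : ℝ) + 1) ^ 2 * ((2 ^ r - 1) + q * 7) := by
      rw [Fin.sum_univ_succ]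
      simp
      left; ring
    refine ⟨q + 1, Fin.cons (2 ^ r) (fun _ => 8), ?_, ?_, ?_, ?_, ?_⟩
    · intro i
      refine Fin.cases ?_ (fun j => ?_) i
      · simpa using Nat.pow_le_pow_right (n := 2) (by norm_num) hr
      · simp
    · rw [Fin.prod_univ_succ]
      simp only [Fin.cons_zero, Fin.cons_succ, Finset.prod_const, Finset.card_univ,
        Fintype.card_fin]
      rw [htq, pow_add, pow_mul, mul_comm]
      norm_num
    · refine ⟨0, Fin.succ ⟨0, hq⟩, ?_⟩
      simp only [Fin.cons_zero, Fin.cons_succ]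
      interval_cases r <;> norm_num
    · rw [hs]; linarith
    · rw [hs]; linarith
  rcases (by omega : t % 3 = 1 ∨ t % 3 = 2) with h | h
  · obtain ⟨k, rfl⟩ : ∃ k, t = 3 * (k + 4) + 1 := ⟨t / 3 - 4, by omega⟩
    refine ⟨k + 4, 1, rfl, by omega, by omega, by omega, ?_⟩
    have hk : (0 : ℝ) ≤ k := Nat.cast_nonneg k
    push_cast
    rw [← sub_pos]
    ring_nf
    positivity
  · obtain ⟨k, rfl⟩ : ∃ k, t = 3 * (k + 3) + 2 := ⟨t / 3 - 3, by omega⟩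
    refine ⟨k + 3, 2, rfl, by omega, by omega, by omega, ?_⟩
    have hk : (0 : ℝ) ≤ k := Nat.cast_nonneg k
    push_cast
    rw [← sub_pos]
    ring_nf
    positivity
end
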